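/- Let g be a reductive Lie algebra with Cartan subalgebra t, roots R, and let H ∈ t and N ∈ u^+ (the sum of positive root spaces of the semisimple part). Then the multiset of eigenvalues of ad(H + N) on g equals {⟨α, H⟩ : α ∈ R ∪ {0}} (with 0 counted with multiplicity dim t plus dim of the center); in particular ad H and ad(H+N) have the same characteristic polynomial. -/

import Mathlib

open LieAlgebra

open Polynomial in
/-- If an endomorphism `T` preserves a finite descending filtration and `n` shifts it by one step,
then `T + n` and `T` have the same characteristic polynomial. -/
theorem LinearMap.charpoly_add_eq_of_filtration {k V : Type*} [Field k] [Infinite k]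
    [AddCommGroup V] [Module k V] [FiniteDimensional k V] (T n : Module.End k V)
    (D : ℕ → Submodule k V) (h_zero : D 0 = ⊤) {m : ℕ} (hm : D m = ⊥)
    (hT : ∀ j, ∀ v ∈ D j, T v ∈ D j) (hn : ∀ j, ∀ v ∈ D j, n v ∈ D (j + 1)) :
    (T + n).charpoly = T.charpoly := by
  apply Polynomial.eq_of_infinite_eval_eq
  refine (T.finite_hasEigenvalue.infinite_compl).mono fun t ht ↦ ?_
  simp only [Set.mem_ofPred_eq, LinearMap.eval_charpoly]
  set G : Module.End k V := algebraMap k _ t - T with hG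
  have hunit : IsUnit G := by
    by_contra h
    exact ht (Module.End.hasEigenvalue_iff_mem_spectrum.mpr h)
  obtain ⟨u, hu⟩ := hunit
  have hGinj : Function.Injective G := by
    rw [← LinearMap.ker_eq_bot, ← LinearMap.isUnit_iff_ker_eq_bot]
    exact ⟨u, hu⟩
  have hGinv : ∀ v, G ((↑u⁻¹ : Module.End k V) v) = v := fun v ↦ by
    rw [← hu, ← Module.End.mul_apply, Units.mul_inv, Module.End.one_apply]
  have hinv : ∀ j, ∀ v ∈ D j, (↑u⁻¹ : Module.End k V) v ∈ D j := by
    intro j v hv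
    have hle : (D j).map G ≤ D j := by
      rintro _ ⟨w, hw, rfl⟩
      simpa [hG, Algebra.algebraMap_eq_smul_one] using
        sub_mem ((D j).smul_mem t hw) (hT j w hw)
    have heq : (D j).map G = D j :=
      Submodule.eq_of_le_of_finrank_eq hle
        (LinearEquiv.finrank_eq (Submodule.equivMapOfInjective G hGinj (D j))).symm
    obtain ⟨w, hw, hwv⟩ := heq.ge hv
    have : (↑u⁻¹ : Module.End k V) v = w := hGinj (by rw [hGinv, hwv])
    rwa [this]
  set f : Module.End k V := ↑u⁻¹ * n with hf
  have hpow : ∀ j v, (f ^ j) v ∈ D j := by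
    intro j
    induction j with
    | zero => simp [h_zero]
    | succ j ih =>
      intro v
      rw [pow_succ', Module.End.mul_apply]
      exact hinv _ _ (hn _ _ (ih v))
  have hnil : IsNilpotent f := ⟨m, LinearMap.ext fun v ↦ by simpa [hm] using hpow m v⟩
  have hdet : LinearMap.det (1 - f) = 1 := by
    have := LinearMap.eval_charpoly f 1
    rw [(LinearMap.isNilpotent_iff_charpoly f).mp hnil] at this
    simpa using this.symm
  have : algebraMap k (Module.End k V) t - (T + n) = G * (1 - f) := by
    rw [mul_sub, mul_one, hf, ← mul_assoc, ← hu, Units.mul_inv, one_mul, hu, hG, sub_sub]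
  rw [this, map_mul, hdet, mul_one]

section

variable {k L : Type*} [Field k] [LieRing L] [LieAlgebra k L]

/-- The descending sequence `L, [K, L], [K, [K, L]], …` for a subspace `K` of a Lie algebra `L`. -/
def Submodule.iteratedLie (K : Submodule k L) : ℕ → Submodule k L
  | 0 => ⊤
  | j + 1 => Submodule.map₂ (LieModule.toEnd k L L : L →ₗ[k] L →ₗ[k] L) K (K.iteratedLie j)

namespace Submodule

theorem lie_mem_iteratedLie_succ {K : Submodule k L} {j : ℕ} {a v : L} (ha : a ∈ K)
    (hv : v ∈ K.iteratedLie j) : ⁅a, v⁆ ∈ K.iteratedLie (j + 1) :=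
  Submodule.apply_mem_map₂ (LieModule.toEnd k L L : L →ₗ[k] L →ₗ[k] L) ha hv

theorem iteratedLie_succ_le {K : Submodule k L} {j : ℕ} {W : Submodule k L} :
    K.iteratedLie (j + 1) ≤ W ↔ ∀ a ∈ K, ∀ v ∈ K.iteratedLie j, ⁅a, v⁆ ∈ W :=
  Submodule.map₂_le

theorem iteratedLie_succ_le_self (K : Submodule k L) (j : ℕ) :
    K.iteratedLie (j + 1) ≤ K.iteratedLie j := by
  induction j with
  | zero => exact le_top
  | succ j ih =>
    exact iteratedLie_succ_le.mpr fun a ha v hv ↦ lie_mem_iteratedLie_succ ha (ih hv)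

theorem lie_mem_iteratedLie_of_normalizes {K : Submodule k L} {s : L}
    (hs : ∀ a ∈ K, ⁅s, a⁆ ∈ K) (j : ℕ) {v : L} (hv : v ∈ K.iteratedLie j) :
    ⁅s, v⁆ ∈ K.iteratedLie j := by
  induction j generalizing v with
  | zero => exact mem_top
  | succ j ih =>
    have : K.iteratedLie (j + 1) ≤
        (K.iteratedLie (j + 1)).comap (LieModule.toEnd k L L s) := by
      refine iteratedLie_succ_le.mpr fun a ha v hv ↦ ?_
      rw [mem_comap, LieModule.toEnd_apply_apply, leibniz_lie]
      exact add_mem (lie_mem_iteratedLie_succ (hs a ha) hv) (lie_mem_iteratedLie_succ ha (ih hv))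
    exact this hv

/-- The inductive step of Engel's theorem: adjoining to `K` an ad-nilpotent element normalizing `K`
preserves nilpotency of the action on `L`. -/
theorem exists_iteratedLie_sup_span_eq_bot {K : Submodule k L} {s : L}
    (hs : ∀ a ∈ K, ⁅s, a⁆ ∈ K) (hnil : IsNilpotent (ad k L s))
    (hK : ∃ m, K.iteratedLie m = ⊥) :
    ∃ m, (K ⊔ span k {s}).iteratedLie m = ⊥ := by
  obtain ⟨p, hp⟩ := hnil
  have step : ∀ j m, (K ⊔ span k {s}).iteratedLie m ≤ K.iteratedLie j → ∀ i,
      (K ⊔ span k {s}).iteratedLie (m + i) ≤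
        (K.iteratedLie j).map (ad k L s ^ i) ⊔ K.iteratedLie (j + 1) := by
    intro j m hm i
    induction i with
    | zero => exact le_sup_of_le_left (by simpa [Module.End.one_eq_id] using hm)
    | succ i ih =>
      refine iteratedLie_succ_le.mpr fun a ha v hv ↦ ?_
      obtain ⟨b, hb, c, hc, rfl⟩ := mem_sup.mp ha
      obtain ⟨r, rfl⟩ := mem_span_singleton.mp hc
      obtain ⟨w, hw, z, hz, rfl⟩ := mem_sup.mp (ih hv)
      obtain ⟨w, hw, rfl⟩ := hw
      have hpow : ∀ q, (ad k L s ^ q) w ∈ K.iteratedLie j := by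
        intro q
        induction q with
        | zero => simpa using hw
        | succ q ihq =>
          rw [pow_succ', Module.End.mul_apply]
          exact lie_mem_iteratedLie_of_normalizes hs j ihq
      rw [add_lie, smul_lie, lie_add s]
      refine add_mem (mem_sup_right (lie_mem_iteratedLie_succ hb (add_mem (hpow i)
        (iteratedLie_succ_le_self K j hz)))) (smul_mem _ r (add_mem (mem_sup_left ⟨w, hw, ?_⟩)
        (mem_sup_right (lie_mem_iteratedLie_of_normalizes hs _ hz))))
      rw [pow_succ', Module.End.mul_apply, ad_apply]
  have key : ∀ j, ∃ m, (K ⊔ span k {s}).iteratedLie m ≤ K.iteratedLie j := by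
    intro j
    induction j with
    | zero => exact ⟨0, le_top⟩
    | succ j ih =>
      obtain ⟨m, hm⟩ := ih
      exact ⟨m + p, (step j m hm p).trans (by simp [hp])⟩
  obtain ⟨m, hm⟩ := hK
  obtain ⟨m', hm'⟩ := key m
  exact ⟨m', le_bot_iff.mp (hm ▸ hm')⟩

/-- Jacobson's theorem on weakly closed sets, for the adjoint action: the span of a set of
ad-nilpotent elements that is closed under the bracket acts nilpotently. -/
theorem exists_iteratedLie_span_eq_bot [FiniteDimensional k L] {S : Set L}
    (hS : ∀ a ∈ S, ∀ b ∈ S, ⁅a, b⁆ ∈ S) (hnil : ∀ a ∈ S, IsNilpotent (ad k L a)) :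
    ∃ m, (span k S).iteratedLie m = ⊥ := by
  let F : Set (Submodule k L) :=
    {K | (∃ A ⊆ S, K = span k A) ∧ ∃ m, K.iteratedLie m = ⊥}
  have hF : F.Nonempty := by
    refine ⟨⊥, ⟨∅, Set.empty_subset S, by simp⟩, 1, ?_⟩
    exact le_bot_iff.mp (iteratedLie_succ_le.mpr fun a ha v _ ↦ by simp [(mem_bot k).mp ha])
  obtain ⟨K, ⟨⟨A, hAS, rfl⟩, hK⟩, hmax⟩ := wellFounded_gt.has_min F hF
  suffices h : S ⊆ span k A by
    have : span k S = span k A := le_antisymm (span_le.mpr h) (span_mono hAS)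
    rwa [this]
  by_contra hSA
  have normalizes : ∃ s ∈ S, s ∉ span k A ∧ ∀ a ∈ A, ⁅a, s⁆ ∈ span k A := by
    by_contra! hcon
    have : ∀ j, ∃ s ∈ S, s ∉ span k A ∧ s ∈ (span k A).iteratedLie j := by
      intro j
      induction j with
      | zero =>
        obtain ⟨s, hs, hsA⟩ := Set.not_subset.mp hSA
        exact ⟨s, hs, hsA, mem_top⟩
      | succ j ih =>
        obtain ⟨s, hs, hsA, hsj⟩ := ih
        obtain ⟨a, ha, has⟩ := hcon s hs hsA
        exact ⟨⁅a, s⁆, hS a (hAS ha) s hs, has, lie_mem_iteratedLie_succ (subset_span ha) hsj⟩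
    obtain ⟨m, hm⟩ := hK
    obtain ⟨s, -, hsA, hsm⟩ := this m
    rw [hm, mem_bot] at hsm
    exact hsA (hsm ▸ zero_mem _)
  obtain ⟨s, hsS, hsA, hs⟩ := normalizes
  have hs' : ∀ a ∈ span k A, ⁅s, a⁆ ∈ span k A := by
    have : span k A ≤ (span k A).comap (ad k L s) := span_le.mpr fun a ha ↦ by
      rw [SetLike.mem_coe, mem_comap, ad_apply, ← lie_skew]
      exact neg_mem (hs a ha)
    exact this
  refine hmax (span k A ⊔ span k {s}) ⟨⟨A ∪ {s}, ?_, (span_union _ _).symm⟩,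
    exists_iteratedLie_sup_span_eq_bot hs' (hnil s hsS) hK⟩ ?_
  · exact Set.union_subset hAS (Set.singleton_subset_iff.mpr hsS)
  · exact left_lt_sup.mpr fun h ↦ hsA (h (mem_span_singleton_self s))

end Submodule

variable [FiniteDimensional k L]

theorem LieAlgebra.rootSpace_zero_ne_bot [Nontrivial L] (H : LieSubalgebra k L)
    [H.IsCartanSubalgebra] : rootSpace H (0 : H → k) ≠ ⊥ := by
  intro h
  have hH : ∀ y : H, y = 0 := fun y ↦ by
    have hy : (y : L) ∈ rootSpace H (0 : H → k) := by
      rw [rootSpace_zero_eq]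
      exact y.2
    rw [h, LieSubmodule.mem_bot] at hy
    exact Subtype.ext hy
  obtain ⟨v, hv⟩ := exists_ne (0 : L)
  have : v ∈ rootSpace H (0 : H → k) :=
    (LieModule.mem_genWeightSpace L _ _).mpr fun y ↦ ⟨1, by simp [hH y]⟩
  rw [h, LieSubmodule.mem_bot] at this
  exact hv this

theorem LieAlgebra.hasEigenvalue_ad_iff_exists_rootSpace_ne_bot (H : LieSubalgebra k L)
    [LieRing.IsNilpotent H] [LieModule.IsTriangularizable k H L] (x : H) (μ : k) :
    (ad k L (x : L)).HasEigenvalue μ ↔ ∃ χ : H → k, rootSpace H χ ≠ ⊥ ∧ χ x = μ := by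
  constructor
  · intro hμ
    by_contra! hcon
    have htop : ⨆ ν, ⨆ (_ : ν ≠ μ), (ad k L (x : L)).maxGenEigenspace ν = ⊤ := by
      rw [eq_top_iff, ← LieSubmodule.top_toSubmodule (R := k) (L := H),
        ← LieModule.iSup_genWeightSpace_eq_top k H L, LieSubmodule.iSup_toSubmodule]
      refine iSup_le fun χ ↦ ?_
      by_cases hχ : rootSpace H χ = ⊥
      · exact (congrArg LieSubmodule.toSubmodule hχ).le.trans (by simp)
      · refine le_iSup₂_of_le (χ x) (hcon χ hχ) fun v hv ↦ ?_
        exact (Module.End.mem_maxGenEigenspace _ _ _).mpr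
          ((LieModule.mem_genWeightSpace L χ v).mp hv x)
    have hdisj := (ad k L (x : L)).independent_maxGenEigenspace μ
    rw [htop, disjoint_top] at hdisj
    exact hμ (le_bot_iff.mp (hdisj ▸ Module.End.eigenspace_le_maxGenEigenspace))
  · rintro ⟨χ, hχ, rfl⟩
    exact LieModule.Weight.hasEigenvalueAt (⟨χ, hχ⟩ : LieModule.Weight k H L) x

end

/-- Let `g` be a (reductive) finite-dimensional Lie algebra with Cartan subalgebra
`t = H`, admitting a root space decomposition, with `P` a positive system of roots
and `u⁺ = ⨆_{α ∈ P} g_α`. For `x ∈ t` and `n ∈ u⁺`, `ad x` and `ad (x + n)` have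
the same characteristic polynomial, and the eigenvalues of `ad (x + n)` are
exactly the values `⟨α, x⟩` for `α ∈ R ∪ {0}`. -/
theorem stmt11 {k L : Type*} [Field k] [IsAlgClosed k] [CharZero k]
    [LieRing L] [LieAlgebra k L] [FiniteDimensional k L] [Nontrivial L]
    (H : LieSubalgebra k L) [H.IsCartanSubalgebra] [LieModule.IsTriangularizable k H L]
    (P : Set (H → k))
    (hP0 : (0 : H → k) ∉ P)
    (hPadd : ∀ α ∈ P, ∀ β ∈ P, rootSpace H (α + β) ≠ ⊥ → α + β ∈ P)
    (hPfull : ∀ α : H → k, α ≠ 0 → rootSpace H α ≠ ⊥ → (α ∈ P ↔ ¬ (-α ∈ P)))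
    (x : H) (n : L) (hn : n ∈ ⨆ α ∈ P, rootSpace H α) :
    (LieAlgebra.ad k L ((x : L) + n)).charpoly = (LieAlgebra.ad k L (x : L)).charpoly ∧
    ∀ μ : k, (LieAlgebra.ad k L ((x : L) + n)).HasEigenvalue μ ↔
      ∃ χ : H → k, (χ = 0 ∨ rootSpace H χ ≠ ⊥) ∧ χ x = μ := by

  have hrz : rootSpace H (0 : H → k) ≠ ⊥ := rootSpace_zero_ne_bot H
  let S : Set L := {y | ∃ α ∈ P, y ∈ rootSpace H α}
  have hS : ∀ a ∈ S, ∀ b ∈ S, ⁅a, b⁆ ∈ S := by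
    rintro a ⟨α, hα, ha⟩ b ⟨β, hβ, hb⟩
    have hab : ⁅a, b⁆ ∈ rootSpace H (α + β) := lie_mem_genWeightSpace_of_mem_genWeightSpace ha hb
    by_cases h : rootSpace H (α + β) = ⊥
    · rw [h, LieSubmodule.mem_bot] at hab
      exact ⟨α, hα, hab ▸ zero_mem _⟩
    · exact ⟨α + β, hPadd α hα β hβ h, hab⟩
  obtain ⟨m, hm⟩ := Submodule.exists_iteratedLie_span_eq_bot (k := k) hS (by
    rintro a ⟨α, hα, ha⟩
    exact isNilpotent_ad_of_mem_rootSpace H (fun h ↦ hP0 (h ▸ hα)) ha)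
  have hnS : n ∈ Submodule.span k S := by
    have hle : ((⨆ α ∈ P, rootSpace H α : LieSubmodule k H L) : Submodule k L) ≤
        Submodule.span k S := by
      simp only [LieSubmodule.iSup_toSubmodule]
      exact iSup₂_le fun α hα y hy ↦ Submodule.subset_span ⟨α, hα, hy⟩
    exact hle hn
  have hxS : ∀ a ∈ Submodule.span k S, ⁅(x : L), a⁆ ∈ Submodule.span k S := by
    have : Submodule.span k S ≤ (Submodule.span k S).comap (ad k L (x : L)) :=
      Submodule.span_le.mpr fun a ⟨α, hα, ha⟩ ↦
        Submodule.subset_span ⟨α, hα, (rootSpace H α).lie_mem (x := x) ha⟩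
    exact this
  have hchar : (ad k L ((x : L) + n)).charpoly = (ad k L (x : L)).charpoly := by
    rw [map_add]
    exact LinearMap.charpoly_add_eq_of_filtration _ _ (Submodule.span k S).iteratedLie rfl hm
      (fun j v hv ↦ Submodule.lie_mem_iteratedLie_of_normalizes hxS j hv)
      (fun j v hv ↦ Submodule.lie_mem_iteratedLie_succ hnS hv)
  refine ⟨hchar, fun μ ↦ ?_⟩
  rw [Module.End.hasEigenvalue_iff_isRoot_charpoly, hchar,
    ← Module.End.hasEigenvalue_iff_isRoot_charpoly,
    hasEigenvalue_ad_iff_exists_rootSpace_ne_bot]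
  refine exists_congr fun χ ↦ and_congr_left fun _ ↦ ⟨Or.inr, ?_⟩
  rintro (rfl | h)
  · exact hrz
  · exact h
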